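/- arXiv:2111.06820 — 2 statements merged into one kernel-verified Lean document; each statement's English description precedes it below -/
import Mathlib

section
/- Let an instance of the block-angular min-max resource sharing problem with a σ-approximate block solver be given, let ε ∈ (0,1], η := e^ε − 1, and assume η σ λ* < 1. Consider any run of the core algorithm with parameters ε and T, and for t ∈ {1,…,T} define the average dual solution z^{(t)} := (1/t) ∑_{p=1}^{t} y^{(p)} / ‖y^{(p)}‖_1. Then z^{(t)} lies in the probability simplex Δ_m and inf_{x∈𝒳} ⟨z^{(t)}, x⟩ ≥ ((1 − η σ λ*)/(σ (1+ε))) · ( λ* − (log m)/(ε t) ). -/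
open scoped BigOperators


theorem aux_tele (N : ℕ) (g : ℕ → ℝ) (k : ℕ) (hk : k ≤ N) :
    ∑ j ∈ Finset.univ.filter (fun j : Fin N => j.1 < k), (g (j.1 + 1) - g j.1) = g k - g 0 := by
  induction k with
  | zero => simp
  | succ k ih =>
    have hkN : k < N := hk
    have h1 : Finset.univ.filter (fun j : Fin N => j.1 < k + 1)
        = insert (⟨k, hkN⟩ : Fin N) (Finset.univ.filter (fun j : Fin N => j.1 < k)) := by
      ext j
      simp only [Finset.mem_filter, Finset.mem_univ, true_and, Finset.mem_insert, Fin.ext_iff]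
      omega
    rw [h1, Finset.sum_insert (by simp), ih (by omega)]
    simp

theorem aux_card (N : ℕ) (p : Fin N → ℕ) (hpmono : ∀ j k : Fin N, j ≤ k → p j ≤ p k)
    (t : ℕ) (j : Fin N) :
    j.1 < (Finset.univ.filter (fun j : Fin N => p j ≤ t)).card ↔ p j ≤ t := by
  constructor
  · intro h
    by_contra hc
    have : Finset.univ.filter (fun j : Fin N => p j ≤ t) ⊆ Finset.Iio j := by
      intro k hk
      simp only [Finset.mem_filter, Finset.mem_univ, true_and] at hk
      rw [Finset.mem_Iio]
      by_contra hkj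
      have := hpmono j k (not_lt.mp hkj)
      omega
    have := Finset.card_le_card this
    rw [Fin.card_Iio] at this
    omega
  · intro h
    have : Finset.Iic j ⊆ Finset.univ.filter (fun j : Fin N => p j ≤ t) := by
      intro k hk
      simp only [Finset.mem_filter, Finset.mem_univ, true_and]
      exact (hpmono k j (Finset.mem_Iic.mp hk)).trans h
    have := Finset.card_le_card this
    rw [Fin.card_Iic] at this
    omega

theorem aux_exp (ε x : ℝ) (hx0 : 0 ≤ x) (hx1 : x ≤ 1) :
    Real.exp (ε * x) ≤ 1 + (Real.exp ε - 1) * x := by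
  have := convexOn_exp.2 (Set.mem_univ (0:ℝ)) (Set.mem_univ ε) (by linarith : 0 ≤ 1 - x) hx0 (by ring)
  simp only [smul_eq_mul, mul_zero, zero_add, Real.exp_zero, mul_one] at this
  rw [mul_comm ε x]
  linarith

theorem aux_eta (ε : ℝ) (hε : 0 < ε) (hε1 : ε ≤ 1) : Real.exp ε - 1 ≤ ε * (1 + ε) := by
  have := Real.abs_exp_sub_one_sub_id_le (x := ε) (by rw [abs_of_pos hε]; exact hε1)
  have := (abs_le.mp this).2
  nlinarith

theorem aux_log (u L : ℝ) (hu : 0 ≤ u) (huL : u ≤ L) (hL : L < 1) :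
    -Real.log (1 - u) ≤ u / (1 - L) := by
  have h1 : 0 < 1 - u := by linarith
  have h2 := Real.one_sub_inv_le_log_of_pos h1
  have h3 : u / (1 - u) ≤ u / (1 - L) := by
    apply div_le_div_of_nonneg_left hu <;> linarith
  have h4 : (1 - u)⁻¹ - 1 = u / (1 - u) := by field_simp; ring
  linarith

/-- (Bound on the dual error.)  With `ε ∈ (0,1]`, `η := e^ε − 1` and
`η σ λ* < 1`, the average dual solution `z^{(t)} := (1/t) ∑_{p=1}^t y^{(p)}/‖y^{(p)}‖_1`
of any run of the core algorithm lies in the probability simplex `Δ_m` and satisfies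
`inf_{x∈𝒳} ⟨z^{(t)}, x⟩ ≥ ((1 − η σ λ*)/(σ(1+ε))) (λ* − (log m)/(ε t))`. -/
theorem stmt_8 (m : ℕ) (hm : 1 ≤ m)
    (𝒞 : Type) [Fintype 𝒞] [Nonempty 𝒞] [DecidableEq 𝒞]
    (X : 𝒞 → Set (Fin m → ℝ))
    (hXne : ∀ c, (X c).Nonempty) (hXcl : ∀ c, IsClosed (X c))
    (hXcv : ∀ c, Convex ℝ (X c))
    (hXpos : ∀ c, ∀ x ∈ X c, ∀ r, 0 ≤ x r)
    (𝒳 : Set (Fin m → ℝ))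
    (h𝒳 : 𝒳 = {x | ∃ g : 𝒞 → Fin m → ℝ, (∀ c, g c ∈ X c) ∧ x = ∑ c, g c})
    (lam : ℝ) (hlam : lam = ⨅ x : 𝒳, ‖(x : Fin m → ℝ)‖)
    (σ : ℝ) (hσ : 1 ≤ σ)
    (f : 𝒞 → (Fin m → ℝ) → (Fin m → ℝ))
    (hfmem : ∀ c y, (∀ r, 0 ≤ y r) → f c y ∈ X c)
    (hfapx : ∀ c y, (∀ r, 0 ≤ y r) →
      ∑ r, y r * f c y r ≤ σ * ⨅ x : X c, ∑ r, y r * (x : Fin m → ℝ) r)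
    (ε : ℝ) (hε : 0 < ε) (hε1 : ε ≤ 1)
    (η : ℝ) (hη : η = Real.exp ε - 1) (heta_sigma_lam : η * σ * lam < 1)
    -- a run of the core algorithm with parameters ε and T
    (T : ℕ) (N : ℕ) (p : Fin N → ℕ) (Cu : Fin N → 𝒞) (ξ : Fin N → ℝ)
    (hp : ∀ j, 1 ≤ p j ∧ p j ≤ T)
    (hpmono : ∀ j k : Fin N, j ≤ k → p j ≤ p k)
    (hξ0 : ∀ j, 0 ≤ ξ j)
    (w : ℕ → Fin m → ℝ) (hw0 : w 0 = fun _ => 1)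
    (b : Fin N → Fin m → ℝ) (hb : ∀ j, b j = f (Cu j) (w j.1))
    (hwsucc : ∀ j : Fin N, w (j.1 + 1) = fun r => w j.1 r * Real.exp (ε * ξ j * b j r))
    (hstep : ∀ j, ξ j * ‖b j‖ ≤ 1)
    (hphase : ∀ t, 1 ≤ t → t ≤ T → ∀ c,
      ∑ j ∈ Finset.univ.filter (fun j => p j = t ∧ Cu j = c), ξ j = 1)
    (y : ℕ → Fin m → ℝ)
    (hy : ∀ t, y t = w (Finset.univ.filter (fun j : Fin N => p j ≤ t)).card)
    -- the average dual solutions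
    (z : ℕ → Fin m → ℝ)
    (hz : ∀ t, z t = (t : ℝ)⁻¹ • ∑ q ∈ Finset.Icc 1 t, (∑ r, |y q r|)⁻¹ • y q) :
    ∀ t, 1 ≤ t → t ≤ T →
      (∀ r, 0 ≤ z t r ∧ z t r ≤ 1) ∧ (∑ r, z t r = 1) ∧
      (1 - η * σ * lam) / (σ * (1 + ε)) * (lam - Real.log m / (ε * t)) ≤
        ⨅ x : 𝒳, ∑ r, z t r * (x : Fin m → ℝ) r := by
  have hηpos : 0 < η := by rw [hη]; linarith [Real.add_one_le_exp ε]
  have hσpos : 0 < σ := by linarith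
  -- positivity of the prices
  have hw1 : ∀ k, k ≤ N → ∀ r, 1 ≤ w k r ∧ ∀ i, i ≤ k → w i r ≤ w k r := by
    intro k
    induction k with
    | zero =>
      intro _ r
      refine ⟨by simp [hw0], ?_⟩
      intro i hi
      rw [Nat.le_zero.mp hi]
    | succ k ih =>
      intro hk r
      obtain ⟨h1, h2⟩ := ih (by omega) r
      have hwk : ∀ r, 0 ≤ w k r := fun r => zero_le_one.trans (ih (by omega) r).1
      have hs := congrFun (hwsucc ⟨k, hk⟩) r
      simp only at hs
      have hbpos : 0 ≤ b ⟨k, hk⟩ r := by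
        rw [hb]; exact hXpos _ _ (hfmem _ _ hwk) r
      have he : 1 ≤ Real.exp (ε * ξ ⟨k, hk⟩ * b ⟨k, hk⟩ r) :=
        Real.one_le_exp (mul_nonneg (mul_nonneg hε.le (hξ0 _)) hbpos)
      have hle : w k r ≤ w (k+1) r := by
        rw [hs]; exact le_mul_of_one_le_right (hwk r) he
      refine ⟨h1.trans hle, fun i hi => ?_⟩
      rcases Nat.lt_or_ge i (k+1) with h | h
      · exact (h2 i (by omega)).trans hle
      · rw [le_antisymm hi h]
  have hw0' : ∀ k, k ≤ N → ∀ r, 0 ≤ w k r := fun k hk r => zero_le_one.trans (hw1 k hk r).1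
  have hbX : ∀ j, b j ∈ X (Cu j) := fun j => by
    rw [hb]; exact hfmem _ _ (hw0' _ j.2.le)
  have hbpos : ∀ j r, 0 ≤ b j r := fun j r => hXpos _ _ (hbX j) r
  -- optimum of the blocks
  let opt : 𝒞 → (Fin m → ℝ) → ℝ := fun c y => ⨅ x : X c, ∑ r, y r * (x : Fin m → ℝ) r
  have hoptbdd : ∀ c (y : Fin m → ℝ), (∀ r, 0 ≤ y r) →
      BddBelow (Set.range fun x : X c => ∑ r, y r * (x : Fin m → ℝ) r) := by
    intro c y hy
    refine ⟨0, ?_⟩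
    rintro _ ⟨x, rfl⟩
    exact Finset.sum_nonneg fun r _ => mul_nonneg (hy r) (hXpos c _ x.2 r)
  have hoptle : ∀ c (y : Fin m → ℝ), (∀ r, 0 ≤ y r) → ∀ x ∈ X c, opt c y ≤ ∑ r, y r * x r := by
    intro c y hy x hx
    exact ciInf_le (hoptbdd c y hy) ⟨x, hx⟩
  have hopt0 : ∀ c (y : Fin m → ℝ), (∀ r, 0 ≤ y r) → 0 ≤ opt c y := by
    intro c y hy
    exact Real.iInf_nonneg fun x => Finset.sum_nonneg fun r _ => mul_nonneg (hy r) (hXpos c _ x.2 r)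
  have hoptmono : ∀ c (y y' : Fin m → ℝ), (∀ r, 0 ≤ y r) → (∀ r, y r ≤ y' r) →
      opt c y ≤ opt c y' := by
    intro c y y' hy hyy
    haveI : Nonempty (X c) := (hXne c).to_subtype
    refine le_ciInf fun x => (hoptle c y hy x x.2).trans ?_
    exact Finset.sum_le_sum fun r _ => mul_le_mul_of_nonneg_right (hyy r) (hXpos c _ x.2 r)
  let Opt : (Fin m → ℝ) → ℝ := fun y => ∑ c, opt c y
  have hOptle : ∀ (y : Fin m → ℝ), (∀ r, 0 ≤ y r) → ∀ x ∈ 𝒳, Opt y ≤ ∑ r, y r * x r := by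
    intro y hy x hx
    rw [h𝒳] at hx
    obtain ⟨g, hg, rfl⟩ := hx
    have : ∑ r, y r * (∑ c, g c) r = ∑ c, ∑ r, y r * g c r := by
      rw [Finset.sum_comm]
      refine Finset.sum_congr rfl fun r _ => ?_
      rw [Finset.sum_apply, Finset.mul_sum]
    rw [this]
    exact Finset.sum_le_sum fun c _ => hoptle c y hy _ (hg c)
  have hOpt0 : ∀ (y : Fin m → ℝ), (∀ r, 0 ≤ y r) → 0 ≤ Opt y := fun y hy =>
    Finset.sum_nonneg fun c _ => hopt0 c y hy
  have h𝒳ne : Nonempty 𝒳 := by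
    choose g hg using hXne
    exact ⟨⟨∑ c, g c, by rw [h𝒳]; exact ⟨g, hg, rfl⟩⟩⟩
  have h𝒳pos : ∀ x ∈ 𝒳, ∀ r, 0 ≤ x r := by
    intro x hx r
    rw [h𝒳] at hx
    obtain ⟨g, hg, rfl⟩ := hx
    rw [Finset.sum_apply]
    exact Finset.sum_nonneg fun c _ => hXpos c _ (hg c) r
  have hlamle : ∀ x ∈ 𝒳, lam ≤ ‖x‖ := by
    intro x hx
    rw [hlam]
    refine ciInf_le (f := fun x : 𝒳 => ‖(x : Fin m → ℝ)‖) ⟨0, ?_⟩ ⟨x, hx⟩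
    rintro _ ⟨x, rfl⟩
    exact norm_nonneg _
  have hOptlam : ∀ (y : Fin m → ℝ), (∀ r, 0 ≤ y r) → 0 < ∑ r, y r →
      Opt y / (∑ r, y r) ≤ lam := by
    intro y hy hys
    rw [hlam]
    refine le_ciInf fun x => ?_
    rw [div_le_iff₀ hys]
    refine (hOptle y hy x x.2).trans ?_
    rw [Finset.mul_sum]
    refine Finset.sum_le_sum fun r _ => ?_
    rw [mul_comm]
    exact mul_le_mul_of_nonneg_right ((le_abs_self _).trans (norm_le_pi_norm (x : Fin m → ℝ) r)) (hy r)
  -- prices after phases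
  let n : ℕ → ℕ := fun t => (Finset.univ.filter (fun j : Fin N => p j ≤ t)).card
  have hnN : ∀ t, n t ≤ N := fun t => (Finset.card_le_univ _).trans (by simp)
  have hyn : ∀ t, y t = w (n t) := hy
  have hfilt : ∀ t, Finset.univ.filter (fun j : Fin N => j.1 < n t)
      = Finset.univ.filter (fun j : Fin N => p j ≤ t) := by
    intro t
    refine Finset.filter_congr fun j _ => ?_
    exact aux_card N p hpmono t j
  have hy1 : ∀ t r, 1 ≤ y t r := fun t r => by rw [hyn]; exact (hw1 _ (hnN t) r).1
  have hy0 : ∀ t r, 0 ≤ y t r := fun t r => zero_le_one.trans (hy1 t r)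
  let S : ℕ → ℝ := fun k => ∑ r, w k r
  let Y : ℕ → ℝ := fun t => ∑ r, y t r
  have hYle : ∀ t r, y t r ≤ Y t := fun t r =>
    Finset.single_le_sum (f := fun r => y t r) (fun r _ => hy0 t r) (Finset.mem_univ r)
  have hY1 : ∀ t, 1 ≤ Y t := fun t => (hy1 t ⟨0, hm⟩).trans (hYle t _)
  have hYpos : ∀ t, 0 < Y t := fun t => zero_lt_one.trans_le (hY1 t)
  have hYabs : ∀ t, ∑ r, |y t r| = Y t := fun t =>
    Finset.sum_congr rfl fun r _ => abs_of_nonneg (hy0 t r)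
  have hY0 : Y 0 = m := by
    have : n 0 = 0 := by
      simp only [n, Finset.card_eq_zero, Finset.filter_eq_empty_iff]
      intro j _
      have := (hp j).1
      omega
    simp only [Y, hyn, this, hw0]
    simp
  have hYS : ∀ t, Y t = S 0 + ∑ j ∈ Finset.univ.filter (fun j : Fin N => p j ≤ t),
      (S (j.1+1) - S j.1) := by
    intro t
    rw [← hfilt, aux_tele N S (n t) (hnN t)]
    simp only [Y, hyn, S]
    ring
  have hd : ∀ j : Fin N, S (j.1+1) - S j.1 ≤ η * σ * (ξ j * opt (Cu j) (w j.1)) := by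
    intro j
    have hA : S (j.1+1) ≤ S j.1 + η * ξ j * ∑ r, w j.1 r * b j r := by
      simp only [S]
      rw [Finset.mul_sum, ← Finset.sum_add_distrib]
      refine Finset.sum_le_sum fun r _ => ?_
      rw [hwsucc j]
      have hx1 : ξ j * b j r ≤ 1 :=
        (mul_le_mul_of_nonneg_left ((le_abs_self _).trans (norm_le_pi_norm (b j) r)) (hξ0 j)).trans (hstep j)
      have := aux_exp ε (ξ j * b j r) (mul_nonneg (hξ0 j) (hbpos j r)) hx1
      rw [← hη, ← mul_assoc] at this
      calc w j.1 r * Real.exp (ε * ξ j * b j r) ≤ w j.1 r * (1 + η * (ξ j * b j r)) :=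
            mul_le_mul_of_nonneg_left this (hw0' _ j.2.le r)
        _ = _ := by ring
    have hB : ∑ r, w j.1 r * b j r ≤ σ * opt (Cu j) (w j.1) := by
      rw [hb]; exact hfapx (Cu j) (w j.1) (hw0' _ j.2.le)
    have := mul_le_mul_of_nonneg_left hB (mul_nonneg hηpos.le (hξ0 j))
    linarith
  have hphaseY : ∀ t, 1 ≤ t → t ≤ T → Y t - Y (t-1) ≤ η * σ * Opt (y t) := by
    intro t ht htT
    have hsplit : Finset.univ.filter (fun j : Fin N => p j ≤ t)
        = Finset.univ.filter (fun j : Fin N => p j ≤ t - 1) ∪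
          Finset.univ.filter (fun j : Fin N => p j = t) := by
      ext j
      simp only [Finset.mem_filter, Finset.mem_univ, true_and, Finset.mem_union]
      omega
    have hdisj : Disjoint (Finset.univ.filter (fun j : Fin N => p j ≤ t - 1))
        (Finset.univ.filter (fun j : Fin N => p j = t)) := by
      rw [Finset.disjoint_filter]
      intro j _ h
      omega
    have h1 : Y t - Y (t-1) = ∑ j ∈ Finset.univ.filter (fun j : Fin N => p j = t),
        (S (j.1+1) - S j.1) := by
      rw [hYS t, hYS (t-1), hsplit, Finset.sum_union hdisj]
      ring
    rw [h1]
    have h2 : ∑ j ∈ Finset.univ.filter (fun j : Fin N => p j = t), (S (j.1+1) - S j.1)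
        ≤ ∑ j ∈ Finset.univ.filter (fun j : Fin N => p j = t),
          η * σ * (ξ j * opt (Cu j) (y t)) := by
      refine Finset.sum_le_sum fun j hj => (hd j).trans ?_
      refine mul_le_mul_of_nonneg_left (mul_le_mul_of_nonneg_left ?_ (hξ0 j))
        (mul_nonneg hηpos.le hσpos.le)
      refine hoptmono _ _ _ (hw0' _ j.2.le) fun r => ?_
      rw [hyn]
      refine (hw1 _ (hnN t) r).2 _ ?_
      have : p j = t := by simpa using hj
      exact ((aux_card N p hpmono t j).mpr this.le).le
    refine h2.trans (le_of_eq ?_)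
    rw [← Finset.mul_sum]
    congr 1
    rw [← Finset.sum_fiberwise (s := Finset.univ.filter (fun j : Fin N => p j = t)) (g := Cu)]
    refine Finset.sum_congr rfl fun c _ => ?_
    rw [Finset.filter_filter]
    have : ∑ j ∈ Finset.univ.filter (fun j => p j = t ∧ Cu j = c), ξ j * opt (Cu j) (y t)
        = ∑ j ∈ Finset.univ.filter (fun j => p j = t ∧ Cu j = c), ξ j * opt c (y t) := by
      refine Finset.sum_congr rfl fun j hj => ?_
      rw [(Finset.mem_filter.mp hj).2.2]
    rw [this, ← Finset.sum_mul, hphase t ht htT c, one_mul]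
  let a : ℕ → ℝ := fun t => Opt (y t) / Y t
  have ha0 : ∀ t, 0 ≤ a t := fun t => div_nonneg (hOpt0 _ (hy0 t)) (hYpos t).le
  have hal : ∀ t, a t ≤ lam := fun t => hOptlam _ (hy0 t) (hYpos t)
  have hηl : 0 < 1 - η * σ * lam := by linarith
  have hησ : 0 < η * σ := mul_pos hηpos hσpos
  have hlogstep : ∀ t, 1 ≤ t → t ≤ T →
      Real.log (Y t) ≤ Real.log (Y (t-1)) + η * σ * a t / (1 - η * σ * lam) := by
    intro t ht htT
    have h1 := hphaseY t ht htT
    have h2 : Opt (y t) = a t * Y t := (div_mul_cancel₀ _ (hYpos t).ne').symm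
    rw [h2] at h1
    have hu : η * σ * a t ≤ η * σ * lam := mul_le_mul_of_nonneg_left (hal t) hησ.le
    have h3 : Y t * (1 - η * σ * a t) ≤ Y (t-1) := by linarith
    have h4 : 0 < 1 - η * σ * a t := by linarith
    have h5 := Real.log_le_log (mul_pos (hYpos t) h4) h3
    rw [Real.log_mul (hYpos t).ne' h4.ne'] at h5
    have h6 := aux_log (η * σ * a t) (η * σ * lam) (mul_nonneg hησ.le (ha0 t)) hu heta_sigma_lam
    linarith
  have hlogY : ∀ t, t ≤ T → Real.log (Y t) ≤
      Real.log m + η * σ * (∑ q ∈ Finset.Icc 1 t, a q) / (1 - η * σ * lam) := by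
    intro t
    induction t with
    | zero => intro _; simp [hY0]
    | succ t ih =>
      intro ht
      have h1 := ih (by omega)
      have h2 := hlogstep (t+1) (by omega) ht
      rw [Nat.add_sub_cancel] at h2
      rw [Finset.sum_Icc_succ_top (by omega), mul_add, add_div]
      linarith
  intro t ht htT
  have htpos : (0:ℝ) < t := by exact_mod_cast ht
  have hz' : ∀ r, z t r = (t:ℝ)⁻¹ * ∑ q ∈ Finset.Icc 1 t, (Y q)⁻¹ * y q r := by
    intro r
    rw [hz]
    simp only [hYabs, Pi.smul_apply, Finset.sum_apply, smul_eq_mul]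
  have hz0 : ∀ r, 0 ≤ z t r := by
    intro r
    rw [hz']
    exact mul_nonneg (inv_nonneg.mpr htpos.le) (Finset.sum_nonneg fun q _ =>
      mul_nonneg (inv_nonneg.mpr (hYpos q).le) (hy0 q r))
  have hzx : ∀ x : Fin m → ℝ, ∑ r, z t r * x r
      = (t:ℝ)⁻¹ * ∑ q ∈ Finset.Icc 1 t, (∑ r, y q r * x r) / Y q := by
    intro x
    simp only [hz']
    simp only [div_eq_inv_mul, Finset.mul_sum, Finset.sum_mul]
    rw [Finset.sum_comm]
    refine Finset.sum_congr rfl fun q _ => Finset.sum_congr rfl fun r _ => ?_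
    ring
  have hzsum : ∑ r, z t r = 1 := by
    have := hzx (fun _ => 1)
    simp only [mul_one] at this
    rw [this]
    have : ∀ q ∈ Finset.Icc 1 t, (∑ r, y q r) / Y q = 1 := fun q _ => div_self (hYpos q).ne'
    rw [Finset.sum_congr rfl this]
    simp only [Finset.sum_const, Nat.card_Icc, Nat.add_sub_cancel, nsmul_eq_mul, mul_one]
    exact inv_mul_cancel₀ htpos.ne'
  refine ⟨fun r => ⟨hz0 r, ?_⟩, hzsum, ?_⟩
  · rw [← hzsum]
    exact Finset.single_le_sum (f := fun r => z t r) (fun r _ => hz0 r) (Finset.mem_univ r)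
  -- the primal bound
  have hprimal : ε * t * lam ≤ Real.log (Y t) := by
    let G : 𝒞 → Fin m → ℝ := fun c =>
      ∑ j ∈ Finset.univ.filter (fun j => p j ≤ t ∧ Cu j = c), ((t:ℝ)⁻¹ * ξ j) • b j
    have hG : ∀ c, G c ∈ X c := by
      intro c
      refine (hXcv c).sum_mem (fun j _ => mul_nonneg (inv_nonneg.mpr htpos.le) (hξ0 j)) ?_ ?_
      · rw [← Finset.mul_sum]
        rw [← Finset.sum_fiberwise_of_maps_to (t := Finset.Icc 1 t) (g := p)]
        · have : ∀ q ∈ Finset.Icc 1 t, ∑ j ∈ (Finset.univ.filter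
              (fun j => p j ≤ t ∧ Cu j = c)).filter (fun j => p j = q), ξ j = 1 := by
            intro q hq
            rw [Finset.mem_Icc] at hq
            rw [← hphase q hq.1 (hq.2.trans htT) c, Finset.filter_filter]
            refine Finset.sum_congr (Finset.filter_congr fun j _ => ?_) fun _ _ => rfl
            constructor
            · rintro ⟨⟨_, h⟩, h'⟩; exact ⟨h', h⟩
            · rintro ⟨h', h⟩; exact ⟨⟨h' ▸ hq.2, h⟩, h'⟩
          rw [Finset.sum_congr rfl this]
          simp only [Finset.sum_const, Nat.card_Icc, Nat.add_sub_cancel, nsmul_eq_mul, mul_one]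
          exact inv_mul_cancel₀ htpos.ne'
        · intro j hj
          rw [Finset.mem_Icc]
          exact ⟨(hp j).1, (Finset.mem_filter.mp hj).2.1⟩
      · intro j hj
        rw [← (Finset.mem_filter.mp hj).2.2]
        exact hbX j
    have hGX : ∑ c, G c ∈ 𝒳 := by rw [h𝒳]; exact ⟨G, hG, rfl⟩
    have hGs : ∑ c, G c = ∑ j ∈ Finset.univ.filter (fun j => p j ≤ t), ((t:ℝ)⁻¹ * ξ j) • b j := by
      rw [← Finset.sum_fiberwise (s := Finset.univ.filter (fun j : Fin N => p j ≤ t)) (g := Cu)]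
      refine Finset.sum_congr rfl fun c _ => ?_
      rw [Finset.filter_filter]
    have hlogw : ∀ r, Real.log (y t r) = ε * t * (∑ c, G c) r := by
      intro r
      have h1 := aux_tele N (fun k => Real.log (w k r)) (n t) (hnN t)
      simp only [hw0, Real.log_one, sub_zero] at h1
      rw [hyn, ← h1, hfilt, hGs, Finset.sum_apply, Finset.mul_sum]
      refine Finset.sum_congr rfl fun j _ => ?_
      have hwp : 0 < w j.1 r := zero_lt_one.trans_le (hw1 _ j.2.le r).1
      rw [hwsucc j, Real.log_mul hwp.ne' (Real.exp_pos _).ne', Real.log_exp]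
      simp only [Pi.smul_apply, smul_eq_mul]
      field_simp
      ring
    have hεt : 0 < ε * t := mul_pos hε htpos
    have hn : ‖∑ c, G c‖ ≤ Real.log (Y t) / (ε * t) := by
      rw [pi_norm_le_iff_of_nonneg (div_nonneg (Real.log_nonneg (hY1 t)) hεt.le)]
      intro r
      rw [Real.norm_of_nonneg (h𝒳pos _ hGX r), le_div_iff₀ hεt, mul_comm, ← hlogw]
      exact Real.log_le_log (zero_lt_one.trans_le (hy1 t r)) (hYle t r)
    have := (hlamle _ hGX).trans hn
    rw [le_div_iff₀ hεt] at this
    linarith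
  refine le_ciInf fun x => ?_
  set A := ∑ q ∈ Finset.Icc 1 t, a q with hA
  have hA0 : 0 ≤ A := Finset.sum_nonneg fun q _ => ha0 q
  have hxA : (t:ℝ)⁻¹ * A ≤ ∑ r, z t r * (x : Fin m → ℝ) r := by
    rw [hzx]
    refine mul_le_mul_of_nonneg_left (Finset.sum_le_sum fun q _ => ?_) (inv_nonneg.mpr htpos.le)
    exact div_le_div_of_nonneg_right (hOptle _ (hy0 q) x x.2) (hYpos q).le
  refine le_trans ?_ hxA
  have hmain := hprimal.trans (hlogY t htT)
  rw [← hA] at hmain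
  set D := 1 - η * σ * lam with hD
  set B := lam - Real.log m / (ε * t) with hB
  have hBm : ε * t * B = ε * t * lam - Real.log m := by
    rw [hB]; field_simp
  have h1 : ε * t * B * D ≤ η * σ * A := by
    rw [← le_div_iff₀ hηl]
    linarith
  have hηle : η ≤ ε * (1 + ε) := hη ▸ aux_eta ε hε hε1
  have h2 : ε * (t * B * D) ≤ ε * ((1 + ε) * σ * A) := by
    have := mul_le_mul_of_nonneg_right hηle (mul_nonneg hσpos.le hA0)
    linarith
  have h3 := le_of_mul_le_mul_left h2 hε
  rw [div_mul_eq_mul_div, div_le_iff₀ (by positivity), inv_mul_eq_div, div_mul_eq_mul_div,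
    le_div_iff₀ htpos]
  linarith
end

section
/- Let an instance of the block-angular min-max resource sharing problem with an exact block solver (σ = 1) be given. Let λ ∈ 𝒳 be decreasingly minimal in 𝒳 and assume (λ↓)_1 > (λ↓)_2; let r* ∈ ℛ be the unique coordinate with λ_{r*} = (λ↓)_1. Then the instance satisfies local weak duality with respect to S := ℛ \ {r*} and μ := (λ↓)_2; that is, for every family (y^{(C)})_{C∈𝒞} of vectors in ℝ^ℛ_{≥0}, ∑_{C∈𝒞} ∑_{r∈ℛ, r≠r*} y^{(C)}_r · f_C(y^{(C)})_r ≤ (λ↓)_2 · ∑_{r∈ℛ, r≠r*} max_{C∈𝒞} y^{(C)}_r. -/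
open scoped BigOperators

/-- The vector `x` with its entries sorted in decreasing order. -/
noncomputable def sortDesc {m : ℕ} (x : Fin m → ℝ) : Fin m → ℝ :=
  fun i => -(((fun j => -x j) ∘ (Tuple.sort fun j => -x j)) i)

/-- The decreasing preorder: `x ≤_dec y`. -/
def decLE {m : ℕ} (x y : Fin m → ℝ) : Prop :=
  sortDesc x = sortDesc y ∨
    ∃ k : Fin m, sortDesc x k < sortDesc y k ∧
      ∀ j : Fin m, j < k → sortDesc x j = sortDesc y j

lemma sortDesc_anti {m : ℕ} (x : Fin m → ℝ) {i j : Fin m} (h : i ≤ j) :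
    sortDesc x j ≤ sortDesc x i := by
  have := Tuple.monotone_sort (fun j => -x j) h
  unfold sortDesc
  linarith

lemma sortDesc_apply {m : ℕ} (x : Fin m → ℝ) (i : Fin m) :
    sortDesc x i = x (Tuple.sort (fun j => -x j) i) := by
  simp [sortDesc]

lemma exists_idx {m : ℕ} (x : Fin m → ℝ) (r : Fin m) :
    ∃ i, Tuple.sort (fun j => -x j) i = r := (Tuple.sort (fun j => -x j)).surjective r

lemma decLE_zero {m : ℕ} {x y : Fin m → ℝ} (h : decLE x y) (hm : 0 < m) :
    sortDesc x ⟨0, hm⟩ ≤ sortDesc y ⟨0, hm⟩ := by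
  rcases h with h | ⟨k, hk, hj⟩
  · rw [h]
  · by_cases h0 : k = ⟨0, hm⟩
    · subst h0; exact hk.le
    · refine (hj _ ?_).le
      have : k.val ≠ 0 := fun h => h0 (Fin.ext h)
      exact Fin.lt_def.2 (by simp; omega)

lemma le_second {m : ℕ} (h0m : 0 < m) (h1m : 1 < m) (lam : Fin m → ℝ)
    (hgap : sortDesc lam ⟨1, h1m⟩ < sortDesc lam ⟨0, h0m⟩)
    (rs : Fin m) (hrs : lam rs = sortDesc lam ⟨0, h0m⟩) (r : Fin m) (hr : r ≠ rs) :
    lam r ≤ sortDesc lam ⟨1, h1m⟩ := by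
  have key : ∀ i : Fin m, i ≠ ⟨0, h0m⟩ → sortDesc lam i ≤ sortDesc lam ⟨1, h1m⟩ := by
    intro i hi
    apply sortDesc_anti
    have : i.val ≠ 0 := fun h => hi (Fin.ext h)
    exact Fin.le_def.2 (by simp; omega)
  obtain ⟨i, hi⟩ := exists_idx lam r
  obtain ⟨j, hj⟩ := exists_idx lam rs
  have hj0 : j = ⟨0, h0m⟩ := by
    by_contra h
    have := key j h
    rw [sortDesc_apply lam j, hj, hrs] at this
    linarith
  have hi0 : i ≠ ⟨0, h0m⟩ := by
    intro h
    apply hr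
    rw [← hi, ← hj, h, hj0]
  have := key i hi0
  rwa [sortDesc_apply lam i, hi] at this

lemma min_coord {m : ℕ} (h0m : 0 < m) (h1m : 1 < m) (S : Set (Fin m → ℝ)) (hS : Convex ℝ S)
    (hpos : ∀ x ∈ S, ∀ r, 0 ≤ x r) (lam : Fin m → ℝ) (hlam : lam ∈ S)
    (hdm : ∀ y ∈ S, decLE lam y)
    (hgap : sortDesc lam ⟨1, h1m⟩ < sortDesc lam ⟨0, h0m⟩)
    (rs : Fin m) (hrs : lam rs = sortDesc lam ⟨0, h0m⟩) (z : Fin m → ℝ) (hz : z ∈ S) :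
    lam rs ≤ z rs := by
  by_contra! hlt
  set d := sortDesc lam ⟨0, h0m⟩ - sortDesc lam ⟨1, h1m⟩ with hd
  have hd0 : 0 < d := by linarith
  set M := ∑ r, z r with hM
  have hM0 : 0 ≤ M := Finset.sum_nonneg fun r _ => hpos z hz r
  set e := d / (d + M + 1) with he
  have hD : 0 < d + M + 1 := by linarith
  have he0 : 0 < e := by positivity
  have heD : e * (d + M + 1) = d := by rw [he]; field_simp
  have he1 : e < 1 := by rw [he, div_lt_one hD]; linarith
  have heM : e * M < d := by nlinarith
  have hmem : (1 - e) • lam + e • z ∈ S :=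
    hS hlam hz (by linarith) he0.le (by ring)
  have h0 := decLE_zero (hdm _ hmem) h0m
  rw [sortDesc_apply ((1 - e) • lam + e • z)] at h0
  generalize Tuple.sort (fun j => -((1 - e) • lam + e • z) j) ⟨0, h0m⟩ = r at h0
  simp only [Pi.add_apply, Pi.smul_apply, smul_eq_mul] at h0
  by_cases hr : r = rs
  · subst hr
    rw [← hrs] at h0
    nlinarith
  · have h1 := le_second h0m h1m lam hgap rs hrs r hr
    have h2 : z r ≤ M := Finset.single_le_sum (f := z) (fun r _ => hpos z hz r) (Finset.mem_univ r)
    have h3 := hpos lam hlam r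
    have h4 : e * z r ≤ e * M := mul_le_mul_of_nonneg_left h2 he0.le
    nlinarith

/-- For an instance with an exact block solver whose decreasingly minimal
element `λ` has a unique maximum entry (at coordinate `r*`), the instance satisfies local
weak duality w.r.t. `S := ℛ \ {r*}` and `μ := (λ↓)₂`. -/
theorem stmt_13 (m : ℕ) (hm : 2 ≤ m)
    (𝒞 : Type) [Fintype 𝒞] [Nonempty 𝒞]
    (X : 𝒞 → Set (Fin m → ℝ))
    (hXne : ∀ c, (X c).Nonempty) (hXcl : ∀ c, IsClosed (X c))
    (hXcv : ∀ c, Convex ℝ (X c))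
    (hXpos : ∀ c, ∀ x ∈ X c, ∀ r, 0 ≤ x r)
    (𝒳 : Set (Fin m → ℝ))
    (h𝒳 : 𝒳 = {x | ∃ g : 𝒞 → Fin m → ℝ, (∀ c, g c ∈ X c) ∧ x = ∑ c, g c})
    -- an exact block solver (σ = 1)
    (f : 𝒞 → (Fin m → ℝ) → (Fin m → ℝ))
    (hfmem : ∀ c y, (∀ r, 0 ≤ y r) → f c y ∈ X c)
    (hfapx : ∀ c y, (∀ r, 0 ≤ y r) →
      ∑ r, y r * f c y r ≤ ⨅ x : X c, ∑ r, y r * (x : Fin m → ℝ) r)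
    -- the decreasingly minimal element and its unique maximum coordinate
    (lam : Fin m → ℝ) (hlamX : lam ∈ 𝒳) (hdm : ∀ y ∈ 𝒳, decLE lam y)
    (hgap : sortDesc lam ⟨1, by omega⟩ < sortDesc lam ⟨0, by omega⟩)
    (rs : Fin m) (hrs : lam rs = sortDesc lam ⟨0, by omega⟩) :
    ∀ y : 𝒞 → Fin m → ℝ, (∀ c r, 0 ≤ y c r) →
      ∑ c, ∑ r ∈ Finset.univ.erase rs, y c r * f c (y c) r ≤
        sortDesc lam ⟨1, by omega⟩ * ∑ r ∈ Finset.univ.erase rs, ⨆ c, y c r := by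
  classical
  intro y hy
  subst h𝒳
  have hcv : Convex ℝ {x | ∃ g : 𝒞 → Fin m → ℝ, (∀ c, g c ∈ X c) ∧ x = ∑ c, g c} := by
    rintro _ ⟨g, hg, rfl⟩ _ ⟨g', hg', rfl⟩ a b ha hb hab
    refine ⟨fun c => a • g c + b • g' c, fun c => hXcv c (hg c) (hg' c) ha hb hab, ?_⟩
    rw [Finset.sum_add_distrib, Finset.smul_sum, Finset.smul_sum]
  have hps : ∀ x ∈ {x | ∃ g : 𝒞 → Fin m → ℝ, (∀ c, g c ∈ X c) ∧ x = ∑ c, g c},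
      ∀ r, 0 ≤ x r := by
    rintro _ ⟨g, hg, rfl⟩ r
    rw [Finset.sum_apply]
    exact Finset.sum_nonneg fun c _ => hXpos c _ (hg c) r
  have hmin := min_coord (by omega) (by omega) _ hcv hps lam hlamX hdm hgap rs hrs
  have hsec := le_second (by omega) (by omega) lam hgap rs hrs
  obtain ⟨g, hg, hlg⟩ := hlamX
  have hgmin : ∀ c, ∀ x ∈ X c, g c rs ≤ x rs := by
    intro c x hx
    have := hmin (∑ c', Function.update g c x c') ⟨Function.update g c x, by
      intro c'
      by_cases h : c' = c
      · subst h; simpa using hx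
      · simpa [h] using hg c', rfl⟩
    rw [hlg, Finset.sum_update_of_mem (Finset.mem_univ c),
      ← Finset.add_sum_erase _ g (Finset.mem_univ c), Finset.sdiff_singleton_eq_erase] at this
    simp only [Pi.add_apply] at this
    linarith
  have hc : ∀ c, ∑ r ∈ Finset.univ.erase rs, y c r * f c (y c) r ≤
      ∑ r ∈ Finset.univ.erase rs, y c r * g c r := by
    intro c
    have h1 : ∑ r, y c r * f c (y c) r ≤ ∑ r, y c r * g c r := by
      refine (hfapx c (y c) (hy c)).trans ?_
      refine ciInf_le (f := fun x : X c => ∑ r, y c r * (x : Fin m → ℝ) r) ⟨0, ?_⟩ ⟨g c, hg c⟩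
      rintro _ ⟨x, rfl⟩
      exact Finset.sum_nonneg fun r _ => mul_nonneg (hy c r) (hXpos c _ x.2 r)
    rw [← Finset.add_sum_erase _ _ (Finset.mem_univ rs),
      ← Finset.add_sum_erase _ (fun r => y c r * g c r) (Finset.mem_univ rs)] at h1
    have h2 := mul_le_mul_of_nonneg_left (hgmin c _ (hfmem c (y c) (hy c))) (hy c rs)
    linarith
  refine (Finset.sum_le_sum fun c _ => hc c).trans ?_
  rw [Finset.sum_comm, Finset.mul_sum]
  refine Finset.sum_le_sum fun r hr => ?_
  have hsup : ∀ c, y c r ≤ ⨆ c, y c r := fun c =>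
    le_ciSup (f := fun c => y c r) (Set.finite_range _).bddAbove c
  have hs0 : 0 ≤ ⨆ c, y c r := Real.iSup_nonneg fun c => hy c r
  calc ∑ c, y c r * g c r ≤ ∑ c, (⨆ c, y c r) * g c r :=
        Finset.sum_le_sum fun c _ => mul_le_mul_of_nonneg_right (hsup c) (hXpos c _ (hg c) r)
    _ = (⨆ c, y c r) * lam r := by rw [← Finset.mul_sum, hlg, Finset.sum_apply]
    _ ≤ (⨆ c, y c r) * sortDesc lam ⟨1, by omega⟩ :=
        mul_le_mul_of_nonneg_left (hsec r (Finset.ne_of_mem_erase hr)) hs0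
    _ = _ := mul_comm _ _
end
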